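/- The minimum defect over all Mondrian partitions of the 9×9 square equals 6; that is, d(9) = d_3(9) = 6: there is a Mondrian partition of the 9×9 square into three rectangles with defect 6, and no Mondrian partition of the 9×9 square into k ≥ 4 rectangles has defect strictly less than 6. -/

import Mathlib

/-- An axis-aligned rectangle with integer coordinates placed on the grid:
lower-left corner `(x, y)`, width `w`, and height `h`. -/
structure Rect where
  x : ℕ
  y : ℕ
  w : ℕ
  h : ℕ
deriving DecidableEq

/-- The area of a rectangle. -/
def Rect.area (r : Rect) : ℕ := r.w * r.h

/-- Two rectangles are congruent if they have the same dimensions,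
possibly after a ninety-degree rotation. -/
def Rect.Congruent (r s : Rect) : Prop :=
  (r.w = s.w ∧ r.h = s.h) ∨ (r.w = s.h ∧ r.h = s.w)

/-- The rectangle `r` covers the unit grid cell `[i, i+1) × [j, j+1)`. -/
def Rect.Covers (r : Rect) (i j : ℕ) : Prop :=
  r.x ≤ i ∧ i < r.x + r.w ∧ r.y ≤ j ∧ j < r.y + r.h

/-- A Mondrian partition of the `n × n` square: a finite collection of
pairwise non-congruent rectangles with positive integer side lengths that
tile the square (every cell of the square is covered by exactly one
rectangle, and rectangles lie inside the square). -/
structure Mondrian (n : ℕ) where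
  rects : Finset Rect
  pos : ∀ r ∈ rects, 0 < r.w ∧ 0 < r.h
  inside : ∀ r ∈ rects, r.x + r.w ≤ n ∧ r.y + r.h ≤ n
  cover : ∀ i j : ℕ, i < n → j < n → ∃! r : Rect, r ∈ rects ∧ r.Covers i j
  noncong : ∀ r ∈ rects, ∀ s ∈ rects, r ≠ s → ¬ r.Congruent s

/-- The defect of a Mondrian partition: the difference between the largest
and the smallest rectangle areas. -/
def Mondrian.defect {n : ℕ} (P : Mondrian n) : ℕ :=
  P.rects.sup fun r => P.rects.sup fun s => r.area - s.area

/-- A Mondrian partition is perfect if all its rectangles have the same area. -/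
def Mondrian.IsPerfect {n : ℕ} (P : Mondrian n) : Prop :=
  ∀ r ∈ P.rects, ∀ s ∈ P.rects, r.area = s.area

/-- `mondrianDk n k` is the minimum defect over all Mondrian partitions of the
`n × n` square using exactly `k` rectangles. -/
noncomputable def mondrianDk (n k : ℕ) : ℕ :=
  sInf {d | ∃ P : Mondrian n, P.rects.card = k ∧ P.defect = d}

/-- `mondrianD n` is the minimum defect over all Mondrian partitions of the
`n × n` square (into at least two rectangles). -/
noncomputable def mondrianD (n : ℕ) : ℕ :=
  sInf {d | ∃ P : Mondrian n, 2 ≤ P.rects.card ∧ P.defect = d}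

instance (r : Rect) (i j : ℕ) : Decidable (r.Covers i j) :=
  inferInstanceAs (Decidable (_ ∧ _ ∧ _ ∧ _))

instance (r s : Rect) : Decidable (r.Congruent s) :=
  inferInstanceAs (Decidable (_ ∨ _))

/-- The rectangles `r` and `s` lie on different sides of some grid line. -/
def Rect.Separated (r s : Rect) : Prop :=
  r.x + r.w ≤ s.x ∨ s.x + s.w ≤ r.x ∨ r.y + r.h ≤ s.y ∨ s.y + s.h ≤ r.y

instance (r s : Rect) : Decidable (r.Separated s) :=
  inferInstanceAs (Decidable (_ ∨ _ ∨ _ ∨ _))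

/-- Backtracking search through the last `k` cells of the `n × n` square, in row order: `true`
means that the rectangles in `L` do not extend to a Mondrian partition whose further rectangles
have their lower-left corners in these cells and their dimensions in `D`. -/
def refutes (n : ℕ) (D : List (ℕ × ℕ)) : ℕ → List Rect → Bool
  | 0, _ => false
  | k + 1, L =>
    L.any (fun r => r.Covers ((n * n - (k + 1)) % n) ((n * n - (k + 1)) / n)) && refutes n D k L ||
    !L.any (fun r => r.Covers ((n * n - (k + 1)) % n) ((n * n - (k + 1)) / n)) &&
    D.all fun d =>
      let r : Rect := ⟨(n * n - (k + 1)) % n, (n * n - (k + 1)) / n, d.1, d.2⟩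
      !(decide (r.x + r.w ≤ n ∧ r.y + r.h ≤ n) &&
        L.all fun s => r.Separated s ∧ ¬ r.Congruent s) || refutes n D k (r :: L)

/-- The dimensions of the rectangles that fit into the `n × n` square and have area between `m`
and `m + 5`. -/
def dims (n m : ℕ) : List (ℕ × ℕ) :=
  (List.range (n + 1) ×ˢ List.range (n + 1)).filter fun d => m ≤ d.1 * d.2 ∧ d.1 * d.2 ≤ m + 5

namespace Mondrian

variable {n : ℕ} (P : Mondrian n)

theorem eq_of_covers {r s : Rect} (hr : r ∈ P.rects) (hs : s ∈ P.rects) {i j : ℕ}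
    (hri : r.Covers i j) (hsi : s.Covers i j) : r = s := by
  have h := P.inside r hr
  exact (P.cover i j (by have := hri.2.1; omega) (by have := hri.2.2.2; omega)).unique
    ⟨hr, hri⟩ ⟨hs, hsi⟩

theorem separated {r s : Rect} (hr : r ∈ P.rects) (hs : s ∈ P.rects) (hne : r ≠ s) :
    r.Separated s := by
  by_contra h
  have h₁ := P.pos r hr
  have h₂ := P.pos s hs
  unfold Rect.Separated at h
  refine hne (P.eq_of_covers hr hs (i := max r.x s.x) (j := max r.y s.y) ?_ ?_) <;>
    unfold Rect.Covers <;> omega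

theorem refutes_eq_false {D : List (ℕ × ℕ)} (hD : ∀ r ∈ P.rects, (r.w, r.h) ∈ D) :
    ∀ (k : ℕ) (L : List Rect), k ≤ n * n → (∀ s ∈ L, s ∈ P.rects) →
      (∀ r ∈ P.rects, r.x + n * r.y < n * n - k → r ∈ L) → refutes n D k L = false := by
  intro k
  induction k with
  | zero => intros; rfl
  | succ k ih =>
    intro L hk hL hP
    have hn : 0 < n := Nat.pos_of_ne_zero (by rintro rfl; omega)
    rw [refutes]
    obtain ⟨c, hc⟩ : ∃ c, c = n * n - (k + 1) := ⟨_, rfl⟩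
    rw [← hc] at hP ⊢
    have hck : n * n - k = c + 1 := by omega
    rw [hck] at ih
    have hi : c % n < n := Nat.mod_lt _ hn
    have hj : c / n < n := Nat.div_lt_of_lt_mul (by omega)
    have hij : c % n + n * (c / n) = c := Nat.mod_add_div c n
    have hcorner : ∀ s ∈ P.rects, s.x + n * s.y = c → s.x = c % n ∧ s.y = c / n := by
      intro s hs h
      have h₁ := P.pos s hs
      have h₂ := P.inside s hs
      have hx : s.x < n := by omega
      rw [← h, Nat.add_mul_mod_self_left, Nat.mod_eq_of_lt hx, Nat.add_mul_div_left _ _ hn,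
        Nat.div_eq_of_lt hx]
      simp
    have hcover : ∀ s ∈ P.rects, s.x + n * s.y = c → s.Covers (c % n) (c / n) := by
      intro s hs h
      obtain ⟨hx, hy⟩ := hcorner s hs h
      have h₁ := P.pos s hs
      unfold Rect.Covers
      omega
    by_cases hcov : ∃ t ∈ L, t.Covers (c % n) (c / n)
    · have hany : L.any (fun r => r.Covers (c % n) (c / n)) = true := by simpa using hcov
      rw [hany, ih L (by omega) hL]
      · simp
      · intro s hs h
        obtain ⟨t, ht, htc⟩ := hcov
        rcases Nat.lt_succ_iff_lt_or_eq.1 h with h | h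
        · exact hP s hs h
        · rwa [P.eq_of_covers hs (hL t ht) (hcover s hs h) htc]
    · have hany : L.any (fun r => r.Covers (c % n) (c / n)) = false := by simpa using hcov
      obtain ⟨r, ⟨hr, hrc⟩, -⟩ := P.cover _ _ hi hj
      have hrL : r ∉ L := fun h => hcov ⟨r, h, hrc⟩
      have hrx : r.x + n * r.y = c := by
        have h₁ : n * r.y ≤ n * (c / n) := Nat.mul_le_mul_left n hrc.2.2.1
        have h₂ := hrc.1
        have h₃ := mt (hP r hr) hrL
        omega
      obtain ⟨hx, hy⟩ := hcorner r hr hrx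
      rw [hany]
      simp only [Bool.false_and, Bool.false_or, Bool.not_false, Bool.true_and]
      refine List.all_eq_false.2 ⟨(r.w, r.h), hD r hr, ?_⟩
      have hreq : (⟨c % n, c / n, r.w, r.h⟩ : Rect) = r := by rw [← hx, ← hy]
      simp only [hreq]
      rw [ih (r :: L) (by omega)]
      · have h₁ : ∀ s ∈ L, r.Separated s ∧ ¬ r.Congruent s := by
          intro s hs
          have hne : r ≠ s := fun h => hrL (h ▸ hs)
          exact ⟨P.separated hr (hL s hs) hne, P.noncong r hr s (hL s hs) hne⟩
        simpa [← hx, ← hy, P.inside r hr] using h₁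
      · simpa using ⟨hr, hL⟩
      · intro s hs h
        rcases Nat.lt_succ_iff_lt_or_eq.1 h with h | h
        · exact List.mem_cons_of_mem _ (hP s hs h)
        · rw [P.eq_of_covers hs hr (hcover s hs h) hrc]
          exact List.mem_cons_self

theorem sum_area : ∑ r ∈ P.rects, r.area = n * n := by
  have hcell : ∀ r ∈ P.rects,
      ((Finset.range n ×ˢ Finset.range n).filter fun p => r.Covers p.1 p.2).card = r.area := by
    intro r hr
    have h := P.inside r hr
    have : ((Finset.range n ×ˢ Finset.range n).filter fun p => r.Covers p.1 p.2) =
        Finset.Ico r.x (r.x + r.w) ×ˢ Finset.Ico r.y (r.y + r.h) := by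
      ext ⟨i, j⟩
      simp only [Finset.mem_filter, Finset.mem_product, Finset.mem_range, Finset.mem_Ico]
      unfold Rect.Covers
      omega
    rw [this]
    simp [Rect.area]
  rw [← Finset.sum_congr rfl hcell, ← Finset.card_biUnion]
  · have : (P.rects.biUnion fun r =>
        (Finset.range n ×ˢ Finset.range n).filter fun p => r.Covers p.1 p.2) =
        Finset.range n ×ˢ Finset.range n := by
      ext ⟨i, j⟩
      simp only [Finset.mem_biUnion, Finset.mem_filter, Finset.mem_product, Finset.mem_range]
      constructor
      · rintro ⟨r, -, h, -⟩
        exact h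
      · rintro ⟨hi, hj⟩
        obtain ⟨r, ⟨hr, hrc⟩, -⟩ := P.cover i j hi hj
        exact ⟨r, hr, ⟨hi, hj⟩, hrc⟩
    rw [this]
    simp
  · intro r hr s hs hne
    rw [Function.onFun, Finset.disjoint_left]
    intro p hp hq
    exact hne (P.eq_of_covers hr hs (Finset.mem_filter.1 hp).2 (Finset.mem_filter.1 hq).2)

theorem area_le_add_defect {r s : Rect} (hr : r ∈ P.rects) (hs : s ∈ P.rects) :
    r.area ≤ s.area + P.defect := by
  have h₁ : r.area - s.area ≤ P.rects.sup fun s => r.area - s.area :=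
    Finset.le_sup (f := fun s => r.area - s.area) hs
  have h₂ : (P.rects.sup fun s => r.area - s.area) ≤ P.defect :=
    Finset.le_sup (f := fun r => P.rects.sup fun s => r.area - s.area) hr
  omega

/-- A partition contains at most one rectangle from each congruence class. -/
theorem exists_subset_sum_area {D : List (ℕ × ℕ)} (hD : ∀ r ∈ P.rects, (r.w, r.h) ∈ D)
    (hswap : ∀ d ∈ D, d.swap ∈ D) :
    ∃ T ⊆ D.toFinset.filter (fun d => d.1 ≤ d.2), ∑ d ∈ T, d.1 * d.2 = n * n := by
  let f : Rect → ℕ × ℕ := fun r => (min r.w r.h, max r.w r.h)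
  have hinj : Set.InjOn f P.rects := by
    intro r hr s hs h
    by_contra hne
    refine P.noncong r hr s hs hne ?_
    simp only [f, Prod.mk.injEq] at h
    unfold Rect.Congruent
    omega
  have harea : ∀ r : Rect, (f r).1 * (f r).2 = r.area := fun r => min_mul_max r.w r.h
  refine ⟨P.rects.image f, fun d hd => ?_, ?_⟩
  · obtain ⟨r, hr, rfl⟩ := Finset.mem_image.1 hd
    refine Finset.mem_filter.2 ⟨List.mem_toFinset.2 ?_, min_le_max⟩
    rcases le_total r.w r.h with h | h
    · simpa [f, h] using hD r hr
    · simpa [f, h] using hswap _ (hD r hr)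
  · rw [Finset.sum_image hinj]
    simp only [harea, P.sum_area]

end Mondrian

theorem sum_dims_nine_lt : ∀ m < 11, 0 < m →
    ∑ d ∈ (dims 9 m).toFinset with d.1 ≤ d.2, d.1 * d.2 < 9 * 9 := by
  decide +kernel

theorem sum_ne_of_subset_dims_nine : ∀ m < 41, 11 ≤ m → m ≠ 13 → m ≠ 14 →
    ∀ T ∈ ((dims 9 m).toFinset.filter fun d => d.1 ≤ d.2).powerset,
      ∑ d ∈ T, d.1 * d.2 ≠ 9 * 9 := by
  decide +kernel

theorem dims_nine_fourteen : dims 9 14 = dims 9 13 := by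
  decide +kernel

theorem refutes_dims_nine : refutes 9 (dims 9 13) (9 * 9) [] = true := by
  decide +kernel

theorem Mondrian.six_le_defect (P : Mondrian 9) (hP : 2 ≤ P.rects.card) : 6 ≤ P.defect := by
  by_contra! hlt
  obtain ⟨r₀, hr₀, hmin⟩ := P.rects.exists_min_image Rect.area (Finset.card_pos.1 (by omega))
  have hpos : 0 < r₀.area := Nat.mul_pos (P.pos r₀ hr₀).1 (P.pos r₀ hr₀).2
  have hle : r₀.area < 41 := by
    have h₁ := Finset.card_nsmul_le_sum P.rects Rect.area r₀.area hmin
    rw [P.sum_area, smul_eq_mul] at h₁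
    have h₂ := Nat.mul_le_mul_right r₀.area hP
    omega
  have hD : ∀ r ∈ P.rects, (r.w, r.h) ∈ dims 9 r₀.area := by
    intro r hr
    have h₁ := P.inside r hr
    have h₂ := P.area_le_add_defect hr hr₀
    have h₃ := hmin r hr
    unfold Rect.area at h₂ h₃
    unfold dims
    simp only [List.mem_filter, List.mem_product, List.mem_range, decide_eq_true_eq]
    unfold Rect.area
    omega
  obtain ⟨T, hT, hsum⟩ := P.exists_subset_sum_area hD <| by
    rintro ⟨a, b⟩ hab
    simp only [dims, List.mem_filter, List.mem_product, Prod.swap, decide_eq_true_eq] at hab ⊢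
    rwa [mul_comm b a, and_comm (a := b ∈ _)]
  have h₁ : 11 ≤ r₀.area := by
    by_contra! h
    exact (hsum ▸ Finset.sum_le_sum_of_subset hT).not_gt (sum_dims_nine_lt _ h hpos)
  have h₂ : dims 9 r₀.area = dims 9 13 := by
    by_cases h13 : r₀.area = 13
    · rw [h13]
    by_cases h14 : r₀.area = 14
    · rw [h14, dims_nine_fourteen]
    exact absurd hsum
      (sum_ne_of_subset_dims_nine _ hle h₁ h13 h14 T (Finset.mem_powerset.2 hT))
  have h₃ := P.refutes_eq_false (h₂ ▸ hD) (9 * 9) [] le_rfl (by simp) (by simp)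
  rw [refutes_dims_nine] at h₃
  exact Bool.false_ne_true h₃.symm

/-- The partition of the `9 × 9` square into rectangles of dimensions `9 × 3`, `4 × 6`, `5 × 6`. -/
def mondrianNineThree : Mondrian 9 where
  rects := {⟨0, 0, 9, 3⟩, ⟨0, 3, 4, 6⟩, ⟨4, 3, 5, 6⟩}
  pos := by decide
  inside := by decide
  cover := by
    intro i j hi hj
    simp only [Finset.mem_insert, Finset.mem_singleton]
    by_cases h₁ : j < 3
    · refine ⟨⟨0, 0, 9, 3⟩, ⟨by simp, by simp only [Rect.Covers]; omega⟩, ?_⟩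
      rintro _ ⟨rfl | rfl | rfl, h⟩ <;> simp only [Rect.Covers] at h <;> first | rfl | omega
    by_cases h₂ : i < 4
    · refine ⟨⟨0, 3, 4, 6⟩, ⟨by simp, by simp only [Rect.Covers]; omega⟩, ?_⟩
      rintro _ ⟨rfl | rfl | rfl, h⟩ <;> simp only [Rect.Covers] at h <;> first | rfl | omega
    · refine ⟨⟨4, 3, 5, 6⟩, ⟨by simp, by simp only [Rect.Covers]; omega⟩, ?_⟩
      rintro _ ⟨rfl | rfl | rfl, h⟩ <;> simp only [Rect.Covers] at h <;> first | rfl | omega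
  noncong := by decide

theorem mondrianNineThree_card : mondrianNineThree.rects.card = 3 := by decide

theorem mondrianNineThree_defect : mondrianNineThree.defect = 6 := by decide

/-- The minimum defect over all Mondrian partitions of the `9 × 9` square is `6`:
`d(9) = d_3(9) = 6`, there is a Mondrian partition into three rectangles with
defect `6`, and no Mondrian partition into `k ≥ 4` rectangles has defect
strictly less than `6`. -/
theorem mondrian_nine : mondrianD 9 = 6 ∧ mondrianDk 9 3 = 6 ∧
    (∃ P : Mondrian 9, P.rects.card = 3 ∧ P.defect = 6) ∧
    ∀ P : Mondrian 9, 4 ≤ P.rects.card → ¬ P.defect < 6 := by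
  have hmem : ∀ S : Set ℕ, 6 ∈ S → (∀ d ∈ S, 6 ≤ d) → sInf S = 6 := fun S h₁ h₂ =>
    IsLeast.csInf_eq ⟨h₁, h₂⟩
  have hcard := mondrianNineThree_card
  have hdefect := mondrianNineThree_defect
  refine ⟨hmem _ ⟨mondrianNineThree, by omega, hdefect⟩ ?_,
    hmem _ ⟨mondrianNineThree, hcard, hdefect⟩ ?_, ⟨mondrianNineThree, hcard, hdefect⟩,
    fun P hP => (P.six_le_defect (by omega)).not_gt⟩
  · rintro _ ⟨P, hP, rfl⟩
    exact P.six_le_defect hP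
  · rintro _ ⟨P, hP, rfl⟩
    exact P.six_le_defect (by omega)
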